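/- Under Assumption A, let δ, c₁, c₂, C₀ > 0 and λ ≥ 1, let (x,ξ) ∈ ℝ^{2n}, and suppose the Hamilton flow (y^λ(t), η^λ(t)) = exp(tH_{p^λ})(x,ξ) satisfies |y^λ(t)| ≥ c₁ t − c₂ and |η^λ(t)| ≤ C₀ for 0 ≤ t ≤ δλ. Then there is C > 0, depending only on δ, c₁, c₂, C₀ and the constants in Assumption A (not on λ), such that for 0 ≤ t ≤ δλ the scattering coordinates (z^λ(t), ζ^λ(t)) = exp(−tH_{p₀^λ}) ∘ exp(tH_{p^λ})(x,ξ) satisfy |(d/dt) z^λ(t)| ≤ C⟨t⟩^{−μ} and |(d/dt) ζ^λ(t)| ≤ C⟨t⟩^{−μ−1}. -/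

import Mathlib

open Real Filter
open scoped BigOperators Topology

noncomputable section

/-- Euclidean configuration space `ℝⁿ`. -/
abbrev En (n : ℕ) := EuclideanSpace ℝ (Fin n)

/-- Partial derivative `∂f/∂x_j` of a function on `ℝⁿ`. -/
noncomputable def pd {n : ℕ} (f : En n → ℝ) (j : Fin n) (x : En n) : ℝ :=
  fderiv ℝ f x (EuclideanSpace.single j 1)

/-- Japanese bracket `⟨x⟩ = (1+|x|²)^{1/2}` on `ℝⁿ`. -/
noncomputable def jb {n : ℕ} (x : En n) : ℝ := Real.sqrt (1 + ‖x‖ ^ 2)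

/-- Japanese bracket `⟨t⟩` on `ℝ`. -/
noncomputable def jbR (t : ℝ) : ℝ := Real.sqrt (1 + t ^ 2)

/-- Kronecker delta. -/
def kdelta {n : ℕ} (j k : Fin n) : ℝ := if j = k then 1 else 0

/-- Assumption A: smooth symmetric positive-definite coefficients `a_{jk}` which are a
short-range perturbation of `δ_{jk}`, and a potential `V = O(⟨x⟩^{2-μ})`, with symbol-type
bounds on all derivatives. -/
structure AssumptionA (n : ℕ) (a : Fin n → Fin n → En n → ℝ) (V : En n → ℝ) (μ : ℝ) : Prop where
  n_pos : 0 < n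
  one_lt_mu : 1 < μ
  smooth_a : ∀ j k, ContDiff ℝ (⊤ : ℕ∞) (a j k)
  smooth_V : ContDiff ℝ (⊤ : ℕ∞) V
  symm : ∀ j k x, a j k x = a k j x
  posdef : ∀ x (ξ : En n), ξ ≠ 0 → 0 < ∑ j, ∑ k, a j k x * ξ j * ξ k
  decay_a : ∀ (m : ℕ) (j k : Fin n), ∃ C > 0, ∀ x,
      ‖iteratedFDeriv ℝ m (fun y => a j k y - kdelta j k) x‖ ≤ C * jb x ^ (-μ - (m : ℝ))
  decay_V : ∀ (m : ℕ), ∃ C > 0, ∀ x,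
      ‖iteratedFDeriv ℝ m V x‖ ≤ C * jb x ^ (2 - μ - (m : ℝ))

/-- Kinetic energy symbol `k(x,ξ) = ½ Σ a_{jk}(x) ξ_j ξ_k`. -/
noncomputable def ksym {n : ℕ} (a : Fin n → Fin n → En n → ℝ) (x ξ : En n) : ℝ :=
  (1 / 2) * ∑ j, ∑ k, a j k x * ξ j * ξ k

/-- Full symbol `p(x,ξ) = k(x,ξ) + ½|x|² + V(x)`. -/
noncomputable def psym {n : ℕ} (a : Fin n → Fin n → En n → ℝ) (V : En n → ℝ) (x ξ : En n) : ℝ :=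
  ksym a x ξ + ‖x‖ ^ 2 / 2 + V x

/-- Scaled symbol `p^λ(x,ξ) = k(x,ξ) + |x|²/(2λ²) + V(x)/λ²`. -/
noncomputable def plam {n : ℕ} (a : Fin n → Fin n → En n → ℝ) (V : En n → ℝ) (lam : ℝ)
    (x ξ : En n) : ℝ :=
  ksym a x ξ + ‖x‖ ^ 2 / (2 * lam ^ 2) + V x / lam ^ 2

/-- `(y,η)` is a (global) solution of the Hamilton equations of `k(x,ξ)=½Σa_{jk}(x)ξ_jξ_k`. -/
def IsFlowK {n : ℕ} (a : Fin n → Fin n → En n → ℝ) (y η : ℝ → En n) : Prop :=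
  (∀ t (j : Fin n), HasDerivAt (fun s => y s j) (∑ i, a j i (y t) * η t i) t) ∧
  (∀ t (j : Fin n), HasDerivAt (fun s => η s j)
      (-((1 / 2) * ∑ i, ∑ l, pd (a i l) j (y t) * η t i * η t l)) t)

/-- `(y,η)` is a (global) solution of the Hamilton equations of `p(x,ξ)`. -/
def IsFlowP {n : ℕ} (a : Fin n → Fin n → En n → ℝ) (V : En n → ℝ) (y η : ℝ → En n) : Prop :=
  (∀ t (j : Fin n), HasDerivAt (fun s => y s j) (∑ i, a j i (y t) * η t i) t) ∧
  (∀ t (j : Fin n), HasDerivAt (fun s => η s j)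
      (-((1 / 2) * ∑ i, ∑ l, pd (a i l) j (y t) * η t i * η t l + y t j + pd V j (y t))) t)

/-- `(y,η)` is a (global) solution of the Hamilton equations of `p^λ(x,ξ)`. -/
def IsFlowPlam {n : ℕ} (a : Fin n → Fin n → En n → ℝ) (V : En n → ℝ) (lam : ℝ)
    (y η : ℝ → En n) : Prop :=
  (∀ t (j : Fin n), HasDerivAt (fun s => y s j) (∑ i, a j i (y t) * η t i) t) ∧
  (∀ t (j : Fin n), HasDerivAt (fun s => η s j)
      (-((1 / 2) * ∑ i, ∑ l, pd (a i l) j (y t) * η t i * η t l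
          + y t j / lam ^ 2 + pd V j (y t) / lam ^ 2)) t)

/-- First (position) component of `exp(-tH_{p₀^λ})` applied to `(y t, η t)`:
`z^λ(t) = cos(t/λ) y^λ(t) − λ sin(t/λ) η^λ(t)`. -/
noncomputable def zlam {n : ℕ} (lam : ℝ) (y η : ℝ → En n) (t : ℝ) : En n :=
  Real.cos (t / lam) • y t - (lam * Real.sin (t / lam)) • η t

/-- Second (momentum) component: `ζ^λ(t) = λ⁻¹ sin(t/λ) y^λ(t) + cos(t/λ) η^λ(t)`. -/
noncomputable def zetalam {n : ℕ} (lam : ℝ) (y η : ℝ → En n) (t : ℝ) : En n :=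
  (lam⁻¹ * Real.sin (t / lam)) • y t + Real.cos (t / lam) • η t

end

/-- The Euclidean norm is bounded by the `ℓ¹` norm of the coordinates. -/
lemma norm_le_of_abs_coord_le {n : ℕ} (v : En n) (B : ℝ) (h : ∀ j, |v j| ≤ B) :
    ‖v‖ ≤ n * B := by
  have hv : v = ∑ j, v j • EuclideanSpace.single j (1 : ℝ) := by
    ext i
    simp [Finset.sum_apply, Pi.single_apply]
  calc ‖v‖ = ‖∑ j, v j • EuclideanSpace.single j (1 : ℝ)‖ := by rw [← hv]
    _ ≤ ∑ j, ‖v j • EuclideanSpace.single j (1 : ℝ)‖ := norm_sum_le _ _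
    _ ≤ ∑ _j : Fin n, B := Finset.sum_le_sum fun j _ => by
        simpa [norm_smul] using h j
    _ = n * B := by simp

lemma hasDerivAt_of_coord {n : ℕ} {f : ℝ → En n} {f' : En n} {t : ℝ}
    (h : ∀ j, HasDerivAt (fun s => f s j) (f' j) t) : HasDerivAt f f' t := by
  rw [hasDerivAt_iff_hasFDerivAt, ← hasFDerivWithinAt_univ, hasFDerivWithinAt_euclidean]
  intro j
  refine (h j).hasFDerivAt.hasFDerivWithinAt.congr_fderiv ?_
  ext
  simp

lemma abs_pd_le {n : ℕ} (f : En n → ℝ) (j : Fin n) (x : En n) : |pd f j x| ≤ ‖fderiv ℝ f x‖ := by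
  have := (fderiv ℝ f x).le_opNorm (EuclideanSpace.single j 1)
  simpa [pd] using this

lemma one_le_jb {n : ℕ} (x : En n) : 1 ≤ jb x :=
  Real.one_le_sqrt.2 (by nlinarith [sq_nonneg ‖x‖])

lemma norm_le_jb {n : ℕ} (x : En n) : ‖x‖ ≤ jb x :=
  Real.le_sqrt_of_sq_le (by linarith)

lemma one_le_jbR (t : ℝ) : 1 ≤ jbR t :=
  Real.one_le_sqrt.2 (by nlinarith [sq_nonneg t])

lemma le_jbR (t : ℝ) : t ≤ jbR t :=
  Real.le_sqrt_of_sq_le (by linarith)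

lemma jbR_le_one_add {t : ℝ} (ht : 0 ≤ t) : jbR t ≤ 1 + t :=
  Real.sqrt_le_iff.2 ⟨by linarith, by nlinarith⟩

/-- A lower bound linear in time on `‖y‖` gives a lower bound on its Japanese bracket. -/
lemma jbR_le_mul_jb {n : ℕ} {c₁ c₂ t : ℝ} (hc₁ : 0 < c₁) (hc₂ : 0 < c₂) (ht : 0 ≤ t) {y : En n}
    (h : c₁ * t - c₂ ≤ ‖y‖) : jbR t ≤ (1 + (1 + c₂) / c₁) * jb y := by
  have h1 := one_le_jb y
  have h2 := norm_le_jb y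
  have h3 : t ≤ (1 + c₂) / c₁ * jb y := by
    rw [div_mul_eq_mul_div, le_div_iff₀ hc₁]
    nlinarith
  linarith [jbR_le_one_add ht]

lemma rpow_neg_le_of_le_mul {u v K s : ℝ} (hu : 0 < u) (hv : 0 < v) (hK : 0 < K) (hs : 0 ≤ s)
    (h : u ≤ K * v) : v ^ (-s) ≤ K ^ s * u ^ (-s) := by
  have h1 : u ^ s ≤ K ^ s * v ^ s := by
    rw [← Real.mul_rpow hK.le hv.le]
    exact Real.rpow_le_rpow hu.le h hs
  rw [Real.rpow_neg hv.le, Real.rpow_neg hu.le, ← div_eq_mul_inv, inv_eq_one_div,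
    div_le_div_iff₀ (by positivity) (by positivity)]
  linarith

namespace AssumptionA

variable {n : ℕ} {a : Fin n → Fin n → En n → ℝ} {V : En n → ℝ} {μ : ℝ}

lemma exists_abs_sub_kdelta_le (hA : AssumptionA n a V μ) :
    ∃ C > 0, ∀ j k x, |a j k x - kdelta j k| ≤ C * jb x ^ (-μ) := by
  choose C hC h using hA.decay_a 0
  have hnn : ∀ j, 0 ≤ ∑ k, C j k := fun j => Finset.sum_nonneg fun k _ => (hC j k).le
  refine ⟨1 + ∑ j, ∑ k, C j k, by linarith [Finset.sum_nonneg fun j (_ : j ∈ Finset.univ) => hnn j],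
    fun j k x => ?_⟩
  have h0 := h j k x
  rw [norm_iteratedFDeriv_zero] at h0
  have h1 := Finset.single_le_sum (fun k _ => (hC j k).le) (Finset.mem_univ k)
  have h2 := Finset.single_le_sum (fun j _ => hnn j) (Finset.mem_univ j)
  have h3 : 0 ≤ jb x ^ (-μ) := Real.rpow_nonneg (by linarith [one_le_jb x]) _
  refine le_trans (by simpa using h0) (mul_le_mul_of_nonneg_right (by linarith) h3)

lemma exists_abs_pd_le (hA : AssumptionA n a V μ) :
    ∃ C > 0, ∀ i k j x, |pd (a i k) j x| ≤ C * jb x ^ (-(μ + 1)) := by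
  choose C hC h using hA.decay_a 1
  have hnn : ∀ j, 0 ≤ ∑ k, C j k := fun j => Finset.sum_nonneg fun k _ => (hC j k).le
  refine ⟨1 + ∑ j, ∑ k, C j k, by linarith [Finset.sum_nonneg fun j (_ : j ∈ Finset.univ) => hnn j],
    fun i k j x => ?_⟩
  have h0 := h i k x
  rw [norm_iteratedFDeriv_one, fderiv_sub_const, Nat.cast_one,
    show -μ - 1 = -(μ + 1) by ring] at h0
  have h1 := Finset.single_le_sum (fun k _ => (hC i k).le) (Finset.mem_univ k)
  have h2 := Finset.single_le_sum (fun j _ => hnn j) (Finset.mem_univ i)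
  have h3 : 0 ≤ jb x ^ (-(μ + 1)) := Real.rpow_nonneg (by linarith [one_le_jb x]) _
  exact (abs_pd_le _ j x).trans (h0.trans (mul_le_mul_of_nonneg_right (by linarith) h3))

lemma exists_abs_pd_potential_le (hA : AssumptionA n a V μ) :
    ∃ C > 0, ∀ j x, |pd V j x| ≤ C * jb x ^ (-(μ - 1)) := by
  obtain ⟨C, hC, h⟩ := hA.decay_V 1
  refine ⟨C, hC, fun j x => (abs_pd_le V j x).trans ?_⟩
  have h0 := h x
  rwa [norm_iteratedFDeriv_one, Nat.cast_one, show 2 - μ - 1 = -(μ - 1) by ring] at h0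

end AssumptionA

/-- Deviation of the velocity from the free one, `(a(y) - 1) η`. -/
noncomputable def velocityDefect {n : ℕ} (a : Fin n → Fin n → En n → ℝ) (y η : En n)
    (j : Fin n) : ℝ :=
  ∑ i, (a j i y - kdelta j i) * η i

/-- Deviation of the force from the harmonic one,
`½ Σ ∂_j a_{il}(y) η_i η_l + ∂_j V(y) / λ²`. -/
noncomputable def forceDefect {n : ℕ} (a : Fin n → Fin n → En n → ℝ) (V : En n → ℝ) (lam : ℝ)
    (y η : En n) (j : Fin n) : ℝ :=
  (1 / 2) * ∑ i, ∑ l, pd (a i l) j y * η i * η l + pd V j y / lam ^ 2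

lemma velocityDefect_eq {n : ℕ} (a : Fin n → Fin n → En n → ℝ) (y η : En n) (j : Fin n) :
    velocityDefect a y η j = ∑ i, a j i y * η i - η j := by
  simp [velocityDefect, sub_mul, Finset.sum_sub_distrib, kdelta]

lemma abs_velocityDefect_le {n : ℕ} {a : Fin n → Fin n → En n → ℝ} {y η : En n} {A C₀ : ℝ}
    (ha : ∀ j i, |a j i y - kdelta j i| ≤ A) (hη : ∀ i, |η i| ≤ C₀) (j : Fin n) :
    |velocityDefect a y η j| ≤ n * (A * C₀) := by
  calc |velocityDefect a y η j| ≤ ∑ i, |(a j i y - kdelta j i) * η i| :=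
        Finset.abs_sum_le_sum_abs _ _
    _ ≤ ∑ _i : Fin n, A * C₀ := Finset.sum_le_sum fun i _ => by
        rw [abs_mul]
        exact mul_le_mul (ha j i) (hη i) (abs_nonneg _) ((abs_nonneg _).trans (ha j i))
    _ = n * (A * C₀) := by simp

lemma abs_forceDefect_le {n : ℕ} {a : Fin n → Fin n → En n → ℝ} {V : En n → ℝ} {lam : ℝ}
    {y η : En n} {A B C₀ : ℝ} (ha : ∀ i l j, |pd (a i l) j y| ≤ A) (hV : ∀ j, |pd V j y| ≤ B)
    (hη : ∀ i, |η i| ≤ C₀) (j : Fin n) :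
    |forceDefect a V lam y η j| ≤ n * (n * (A * C₀ * C₀)) + B / lam ^ 2 := by
  have h1 : |∑ i, ∑ l, pd (a i l) j y * η i * η l| ≤ n * (n * (A * C₀ * C₀)) := by
    calc |∑ i, ∑ l, pd (a i l) j y * η i * η l|
        ≤ ∑ i, |∑ l, pd (a i l) j y * η i * η l| := Finset.abs_sum_le_sum_abs _ _
      _ ≤ ∑ i, ∑ l, |pd (a i l) j y * η i * η l| :=
        Finset.sum_le_sum fun i _ => Finset.abs_sum_le_sum_abs _ _
      _ ≤ ∑ _i : Fin n, ∑ _l : Fin n, A * C₀ * C₀ :=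
        Finset.sum_le_sum fun i _ => Finset.sum_le_sum fun l _ => by
          have hA := (abs_nonneg _).trans (ha i l j)
          have hC := (abs_nonneg _).trans (hη i)
          rw [abs_mul, abs_mul]
          gcongr
          exacts [ha i l j, hη i, hη l]
      _ = n * (n * (A * C₀ * C₀)) := by simp
  have h2 : |pd V j y / lam ^ 2| ≤ B / lam ^ 2 := by
    rw [abs_div, abs_of_nonneg (sq_nonneg lam)]
    exact div_le_div_of_nonneg_right (hV j) (sq_nonneg lam)
  refine (abs_add_le _ _).trans (add_le_add ?_ h2)
  rw [abs_mul, abs_of_pos (by norm_num : (0 : ℝ) < 1 / 2)]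
  linarith [abs_nonneg (∑ i, ∑ l, pd (a i l) j y * η i * η l)]

section ScatteringCoordinates

variable {n : ℕ} {a : Fin n → Fin n → En n → ℝ} {V : En n → ℝ} {lam : ℝ} {y η : ℝ → En n}

lemma hasDerivAt_cos_div (lam t : ℝ) :
    HasDerivAt (fun s => Real.cos (s / lam)) (-Real.sin (t / lam) * (1 / lam)) t :=
  ((hasDerivAt_id t).div_const lam).cos

lemma hasDerivAt_sin_div (lam t : ℝ) :
    HasDerivAt (fun s => Real.sin (s / lam)) (Real.cos (t / lam) * (1 / lam)) t :=
  ((hasDerivAt_id t).div_const lam).sin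

lemma IsFlowPlam.hasDerivAt_zlam (h : IsFlowPlam a V lam y η) (hlam : lam ≠ 0) (t : ℝ) :
    HasDerivAt (zlam lam y η) (WithLp.toLp 2 fun j =>
      Real.cos (t / lam) * velocityDefect a (y t) (η t) j
        + lam * Real.sin (t / lam) * forceDefect a V lam (y t) (η t) j) t := by
  refine hasDerivAt_of_coord fun j => ?_
  have := ((hasDerivAt_cos_div lam t).mul (h.1 t j)).sub
    (((hasDerivAt_sin_div lam t).const_mul lam).mul (h.2 t j))
  refine this.congr_deriv ?_
  simp only [velocityDefect_eq, forceDefect]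
  field_simp
  ring

lemma IsFlowPlam.hasDerivAt_zetalam (h : IsFlowPlam a V lam y η) (hlam : lam ≠ 0) (t : ℝ) :
    HasDerivAt (zetalam lam y η) (WithLp.toLp 2 fun j =>
      lam⁻¹ * Real.sin (t / lam) * velocityDefect a (y t) (η t) j
        - Real.cos (t / lam) * forceDefect a V lam (y t) (η t) j) t := by
  refine hasDerivAt_of_coord fun j => ?_
  have := (((hasDerivAt_sin_div lam t).const_mul lam⁻¹).mul (h.1 t j)).add
    ((hasDerivAt_cos_div lam t).mul (h.2 t j))
  refine this.congr_deriv ?_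
  simp only [velocityDefect_eq, forceDefect]
  field_simp
  ring

end ScatteringCoordinates

/-- Under Assumption A, if on `[0, δλ]` the flow of `p^λ` satisfies
`|y^λ(t)| ≥ c₁t − c₂` and `|η^λ(t)| ≤ C₀`, then there is `C > 0` depending only on
`δ, c₁, c₂, C₀` and the constants of Assumption A (not on `λ ≥ 1`) with
`|(d/dt) z^λ(t)| ≤ C⟨t⟩^{−μ}` and `|(d/dt) ζ^λ(t)| ≤ C⟨t⟩^{−μ−1}` on `[0, δλ]`. -/
theorem stmt_9 {n : ℕ} (a : Fin n → Fin n → En n → ℝ) (V : En n → ℝ) (μ : ℝ)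
    (hA : AssumptionA n a V μ) (δ c₁ c₂ C₀ : ℝ)
    (hδ : 0 < δ) (hc₁ : 0 < c₁) (hc₂ : 0 < c₂) (hC₀ : 0 < C₀) :
    ∃ C > (0 : ℝ), ∀ lam : ℝ, 1 ≤ lam → ∀ x ξ : En n,
      ∀ y η : ℝ → En n, IsFlowPlam a V lam y η → y 0 = x → η 0 = ξ →
        (∀ t ∈ Set.Icc (0 : ℝ) (δ * lam), c₁ * t - c₂ ≤ ‖y t‖ ∧ ‖η t‖ ≤ C₀) →
        ∀ t ∈ Set.Icc (0 : ℝ) (δ * lam),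
          ‖deriv (zlam lam y η) t‖ ≤ C * jbR t ^ (-μ) ∧
          ‖deriv (zetalam lam y η) t‖ ≤ C * jbR t ^ (-μ - 1) := by
  obtain ⟨A₀, hA₀, ha₀⟩ := hA.exists_abs_sub_kdelta_le
  obtain ⟨A₁, hA₁, ha₁⟩ := hA.exists_abs_pd_le
  obtain ⟨B, hB, hV⟩ := hA.exists_abs_pd_potential_le
  have hμ := hA.one_lt_mu
  have hn : (0 : ℝ) < n := by exact_mod_cast hA.n_pos
  obtain ⟨K, hK⟩ : ∃ K, K = 1 + (1 + c₂) / c₁ := ⟨_, rfl⟩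
  have hKpos : 0 < K := by rw [hK]; positivity
  obtain ⟨E, hE⟩ : ∃ E, E = n * (A₀ * K ^ μ * C₀) := ⟨_, rfl⟩
  obtain ⟨G, hG⟩ : ∃ G, G = n * (n * (A₁ * K ^ (μ + 1) * C₀ * C₀))
    + B * K ^ (μ - 1) * (1 + δ) ^ 2 := ⟨_, rfl⟩
  have hEpos : 0 < E := by rw [hE]; positivity
  have hGpos : 0 < G := by rw [hG]; positivity
  refine ⟨n * ((1 + δ) * E + G), by positivity, ?_⟩
  rintro lam hlam x ξ y η hflow - - hbd t ht
  obtain ⟨hy, hη⟩ := hbd t ht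
  have hlam0 : 0 < lam := by linarith
  have hJ : 0 < jbR t := by linarith [one_le_jbR t]
  have hJlam : jbR t ≤ (1 + δ) * lam := by linarith [jbR_le_one_add ht.1, ht.2]
  have hjb : 0 < jb (y t) := by linarith [one_le_jb (y t)]
  have hJy : jbR t ≤ K * jb (y t) := hK ▸ jbR_le_mul_jb hc₁ hc₂ ht.1 hy
  have hηc : ∀ i, |η t i| ≤ C₀ := fun i => (PiLp.norm_apply_le (η t) i).trans hη
  have hdecay : ∀ s : ℝ, 0 ≤ s → jb (y t) ^ (-s) ≤ K ^ s * jbR t ^ (-s) := fun s hs =>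
    rpow_neg_le_of_le_mul hJ hjb hKpos hs hJy
  have hshift : jbR t ^ (-μ) = jbR t ^ (-μ - 1) * jbR t := by
    rw [← Real.rpow_add_one hJ.ne']; ring_nf
  have hshift2 : jbR t ^ (-(μ - 1)) = jbR t ^ (-μ - 1) * jbR t ^ 2 := by
    rw [← Real.rpow_natCast, ← Real.rpow_add hJ]; norm_num; ring_nf
  have hP : 0 < jbR t ^ (-μ - 1) := Real.rpow_pos_of_pos hJ _
  have hvel : ∀ j, |velocityDefect a (y t) (η t) j| ≤ E * jbR t ^ (-μ) := fun j => by
    refine (abs_velocityDefect_le (A := A₀ * (K ^ μ * jbR t ^ (-μ))) (fun j i => ?_) hηc j).trans_eq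
      (by rw [hE]; ring)
    exact (ha₀ j i _).trans (mul_le_mul_of_nonneg_left (hdecay μ (by linarith)) hA₀.le)
  have hforce : ∀ j, |forceDefect a V lam (y t) (η t) j| ≤ G * jbR t ^ (-μ - 1) := fun j => by
    refine (abs_forceDefect_le (A := A₁ * (K ^ (μ + 1) * jbR t ^ (-(μ + 1))))
      (B := B * (K ^ (μ - 1) * jbR t ^ (-(μ - 1)))) (fun i l j => ?_) (fun j => ?_) hηc j).trans ?_
    · exact (ha₁ i l j _).trans (mul_le_mul_of_nonneg_left (hdecay _ (by linarith)) hA₁.le)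
    · exact (hV j _).trans (mul_le_mul_of_nonneg_left (hdecay _ (by linarith)) hB.le)
    · have hsq : jbR t ^ 2 / lam ^ 2 ≤ (1 + δ) ^ 2 := by
        rw [div_le_iff₀ (by positivity), ← mul_pow]
        gcongr
      have hcoef : 0 ≤ B * K ^ (μ - 1) * jbR t ^ (-μ - 1) := by positivity
      calc _ = n * (n * (A₁ * K ^ (μ + 1) * C₀ * C₀)) * jbR t ^ (-μ - 1)
            + B * K ^ (μ - 1) * jbR t ^ (-μ - 1) * (jbR t ^ 2 / lam ^ 2) := by
            rw [hshift2, neg_add']; ring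
        _ ≤ n * (n * (A₁ * K ^ (μ + 1) * C₀ * C₀)) * jbR t ^ (-μ - 1)
            + B * K ^ (μ - 1) * jbR t ^ (-μ - 1) * (1 + δ) ^ 2 := by gcongr
        _ = G * jbR t ^ (-μ - 1) := by rw [hG]; ring
  have hsin : |lam * Real.sin (t / lam)| ≤ jbR t := by
    rw [abs_mul, abs_of_pos hlam0]
    calc lam * |Real.sin (t / lam)| ≤ lam * |t / lam| := by
          exact mul_le_mul_of_nonneg_left Real.abs_sin_le_abs hlam0.le
      _ = t := by rw [abs_of_nonneg (div_nonneg ht.1 hlam0.le)]; field_simp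
      _ ≤ jbR t := le_jbR t
  have hinv : |lam⁻¹ * Real.sin (t / lam)| * jbR t ≤ 1 + δ := by
    rw [abs_mul, abs_of_pos (inv_pos.2 hlam0)]
    calc lam⁻¹ * |Real.sin (t / lam)| * jbR t ≤ lam⁻¹ * 1 * ((1 + δ) * lam) := by
          gcongr; exact Real.abs_sin_le_one _
      _ = 1 + δ := by field_simp
  rw [(hflow.hasDerivAt_zlam hlam0.ne' t).deriv, (hflow.hasDerivAt_zetalam hlam0.ne' t).deriv,
    mul_assoc, mul_assoc]
  constructor <;> refine norm_le_of_abs_coord_le _ _ fun j => ?_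
  · calc _ ≤ |Real.cos (t / lam)| * |velocityDefect a (y t) (η t) j|
          + |lam * Real.sin (t / lam)| * |forceDefect a V lam (y t) (η t) j| := by
          rw [← abs_mul, ← abs_mul]; exact abs_add_le _ _
      _ ≤ 1 * (E * jbR t ^ (-μ)) + jbR t * (G * jbR t ^ (-μ - 1)) := by
          gcongr
          exacts [Real.abs_cos_le_one _, hvel j, hforce j]
      _ = (E + G) * jbR t ^ (-μ) := by rw [hshift]; ring
      _ ≤ ((1 + δ) * E + G) * jbR t ^ (-μ) := by
          gcongr
          nlinarith
  · calc _ ≤ |lam⁻¹ * Real.sin (t / lam)| * |velocityDefect a (y t) (η t) j|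
          + |Real.cos (t / lam)| * |forceDefect a V lam (y t) (η t) j| := by
          rw [← abs_mul, ← abs_mul]; exact abs_sub _ _
      _ ≤ |lam⁻¹ * Real.sin (t / lam)| * (E * jbR t ^ (-μ)) + 1 * (G * jbR t ^ (-μ - 1)) := by
          gcongr
          exacts [hvel j, Real.abs_cos_le_one _, hforce j]
      _ = (|lam⁻¹ * Real.sin (t / lam)| * jbR t) * (E * jbR t ^ (-μ - 1))
          + G * jbR t ^ (-μ - 1) := by rw [hshift]; ring
      _ ≤ (1 + δ) * (E * jbR t ^ (-μ - 1)) + G * jbR t ^ (-μ - 1) := by gcongr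
      _ = ((1 + δ) * E + G) * jbR t ^ (-μ - 1) := by ring
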